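/- For all integers n ≥ 1 and k ≥ 0, the number of Schröder paths of length 2n having no peak of odd height and exactly k peaks of even height greater than 2 equals the number of UH-free Schröder paths of length 2n whose first step is U and which have exactly k peaks of even height greater than 2. -/

import Mathlib

/-- Steps of a Schröder path: `U = (1,1)`, `D = (1,-1)`, `H = H² = (2,0)`. -/
inductive SStep : Type
  | U : SStep
  | D : SStep
  | H : SStep
  deriving DecidableEq

/-- The contribution of a step to the x-coordinate. -/
def SStep.len : SStep → ℕ
  | U => 1
  | D => 1
  | H => 2

/-- The contribution of a step to the y-coordinate. -/
def SStep.eff : SStep → ℤ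
  | U => 1
  | D => -1
  | H => 0

/-- The height (y-coordinate of the starting point) of the `i`-th step (0-indexed);
for `i = L.length` this is the final height of the path. -/
def sHeight (L : List SStep) (i : ℕ) : ℤ := ((L.take i).map SStep.eff).sum

/-- `L` is a Schröder path of length `2 * n`: it has total horizontal displacement `2 * n`,
ends at height `0`, and never goes below the x-axis. -/
def IsSchroder (L : List SStep) (n : ℕ) : Prop :=
  (L.map SStep.len).sum = 2 * n ∧ (L.map SStep.eff).sum = 0 ∧ ∀ i, 0 ≤ sHeight L i

/-- A peak at position `i`: an up step immediately followed by a down step.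
The height of this peak is `sHeight L (i+1)`, the height of its down step. -/
def IsPeakAt (L : List SStep) (i : ℕ) : Prop :=
  L[i]? = some SStep.U ∧ L[i+1]? = some SStep.D

/-- `L` has no peak of odd height. -/
def NoOddPeak (L : List SStep) : Prop :=
  ∀ i, IsPeakAt L i → ¬ Odd (sHeight L (i+1))

/-- `L` has no peak of even height. -/
def NoEvenPeak (L : List SStep) : Prop :=
  ∀ i, IsPeakAt L i → ¬ Even (sHeight L (i+1))

/-- `L` is UH-free: no up step is immediately followed by a horizontal step. -/
def UHFree (L : List SStep) : Prop :=
  ∀ i, ¬ (L[i]? = some SStep.U ∧ L[i+1]? = some SStep.H)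

/-- The number of peaks of `L` of even height greater than `2`. -/
def evenHighPeaks (L : List SStep) : ℕ :=
  ((Finset.range L.length).filter
    (fun i => L[i]? = some SStep.U ∧ L[i+1]? = some SStep.D ∧
      Even (sHeight L (i+1)) ∧ 2 < sHeight L (i+1))).card

/-- Schröder paths as trees, by first-return decomposition: `flat s` is a horizontal step followed
by `s`, and `arch b t` is `U b D t`. -/
inductive SchroderTree : Type
  | nil : SchroderTree
  | flat : SchroderTree → SchroderTree
  | arch : SchroderTree → SchroderTree → SchroderTree
  deriving DecidableEq

namespace SchroderTree

/-- The path described by a tree. -/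
def toPath : SchroderTree → List SStep
  | nil => []
  | flat s => SStep.H :: toPath s
  | arch b t => SStep.U :: (toPath b ++ SStep.D :: toPath t)

/-- The semilength of the path. -/
def size : SchroderTree → ℕ
  | nil => 0
  | flat s => size s + 1
  | arch b t => size b + size t + 1

/-- The number of peaks of even height greater than `2`, for the path started at height `h`. -/
def evenPeaks (h : ℤ) : SchroderTree → ℕ
  | nil => 0
  | flat s => evenPeaks h s
  | arch b t =>
    (if b = nil ∧ Even (h + 1) ∧ 2 < h + 1 then 1 else 0) + evenPeaks (h + 1) b + evenPeaks h t

/-- The path, started at height `h`, has no peak of odd height. -/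
def NoOdd (h : ℤ) : SchroderTree → Prop
  | nil => True
  | flat s => NoOdd h s
  | arch b t => ¬ (b = nil ∧ Odd (h + 1)) ∧ NoOdd (h + 1) b ∧ NoOdd h t

/-- The path starts with a horizontal step. -/
def IsFlat : SchroderTree → Prop
  | flat _ => True
  | _ => False

/-- The path has no `UH`-pair. -/
def NoUH : SchroderTree → Prop
  | nil => True
  | flat s => NoUH s
  | arch b t => ¬ IsFlat b ∧ NoUH b ∧ NoUH t

mutual
/-- The bijection from paths without odd peaks to `UH`-free paths, at even heights. -/
def evenMap : SchroderTree → SchroderTree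
  | nil => nil
  | flat s => arch nil (evenMap s)
  | arch b t => insertArch b (evenMap t)
/-- The bijection from paths without odd peaks to `UH`-free paths, at odd heights. -/
def oddMap : SchroderTree → SchroderTree
  | nil => nil
  | flat s => flat (oddMap s)
  | arch b t => arch (evenMap b) (oddMap t)
/-- `insertArch b s` is `U (oddMap b) D s` with the initial horizontal steps of `oddMap b` moved
in front of `s`. -/
def insertArch : SchroderTree → SchroderTree → SchroderTree
  | nil, s => arch nil s
  | flat b, s => insertArch b (flat s)
  | arch b t, s => arch (arch (evenMap b) (oddMap t)) s
end

/-- An arch over `b` followed by `t`, with the odd peak replaced by a horizontal step if `b` is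
empty. -/
def archOrFlat : SchroderTree → SchroderTree → SchroderTree
  | nil, t => flat t
  | b, t => arch b t

/-- `flats j s` is `j` horizontal steps followed by `s`. -/
def flats : ℕ → SchroderTree → SchroderTree
  | 0, s => s
  | j + 1, s => flat (flats j s)

/-- For a `UH`-free `s`, the preimage under `oddMap`, the number of initial horizontal steps, and
the preimage of the remainder under `evenMap`. -/
def preimages : SchroderTree → SchroderTree × ℕ × SchroderTree
  | nil => (nil, 0, nil)
  | flat s => (flat (preimages s).1, (preimages s).2.1 + 1, (preimages s).2.2)
  | arch b t => (arch (preimages b).2.2 (preimages t).1, 0,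
      archOrFlat (flats (preimages t).2.1 (preimages b).1) (preimages t).2.2)

theorem flats_flat (j : ℕ) (s : SchroderTree) : flats j (flat s) = flat (flats j s) := by
  induction j with
  | zero => rfl
  | succ j ih => rw [flats, ih, flats]

theorem noOdd_flats (h : ℤ) (j : ℕ) (s : SchroderTree) : NoOdd h (flats j s) ↔ NoOdd h s := by
  induction j with
  | zero => rfl
  | succ j ih => rw [flats, NoOdd, ih]

theorem insertArch_ne_nil (b s : SchroderTree) : insertArch b s ≠ nil := by
  induction b generalizing s with
  | nil => simp [insertArch]
  | flat b ih => rw [insertArch]; exact ih _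
  | arch b t => simp [insertArch]

theorem not_isFlat_insertArch (b s : SchroderTree) : ¬ IsFlat (insertArch b s) := by
  induction b generalizing s with
  | nil => simp [insertArch, IsFlat]
  | flat b ih => rw [insertArch]; exact ih _
  | arch b t => simp [insertArch, IsFlat]

theorem evenMap_eq_nil {s : SchroderTree} : evenMap s = nil ↔ s = nil := by
  cases s <;> simp [evenMap, insertArch_ne_nil]

theorem not_isFlat_evenMap (s : SchroderTree) : ¬ IsFlat (evenMap s) := by
  cases s with
  | nil => simp [evenMap, IsFlat]
  | flat s => simp [evenMap, IsFlat]
  | arch b t => rw [evenMap]; exact not_isFlat_insertArch _ _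

theorem size_maps (s : SchroderTree) :
    size (evenMap s) = size s ∧ size (oddMap s) = size s ∧
      ∀ t, size (insertArch s t) = size s + size t + 1 := by
  induction s with
  | nil => simp [evenMap, oddMap, insertArch, size]
  | flat s ih =>
    refine ⟨by simp [evenMap, size, ih.1], by simp [oddMap, size, ih.2.1], fun t => ?_⟩
    rw [insertArch, ih.2.2, size, size]; omega
  | arch b t ihb iht =>
    refine ⟨by simp [evenMap, size, ihb.2.2, iht.1], by simp [oddMap, size, ihb.1, iht.2.1],
      fun u => ?_⟩
    simp [insertArch, size, ihb.1, iht.2.1]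

theorem noUH_maps (s : SchroderTree) :
    NoUH (evenMap s) ∧ NoUH (oddMap s) ∧ ∀ t, NoUH t → NoUH (insertArch s t) := by
  induction s with
  | nil => simp [evenMap, oddMap, insertArch, NoUH, IsFlat]
  | flat s ih =>
    refine ⟨by simp [evenMap, NoUH, IsFlat, ih.1], by simp [oddMap, NoUH, ih.2.1], fun t ht => ?_⟩
    rw [insertArch]
    exact ih.2.2 _ ht
  | arch b t ihb iht =>
    refine ⟨by rw [evenMap]; exact ihb.2.2 _ iht.1, ?_, fun u hu => ?_⟩
    · simp [oddMap, NoUH, ihb.1, iht.2.1, not_isFlat_evenMap]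
    · rw [insertArch]
      exact ⟨fun h => h, ⟨not_isFlat_evenMap b, ihb.1, iht.2.1⟩, hu⟩

theorem evenPeaks_maps (s : SchroderTree) :
    (∀ h, Even h → evenPeaks h (evenMap s) = evenPeaks h s) ∧
    (∀ h, Odd h → evenPeaks h (oddMap s) = evenPeaks h s) ∧
    ∀ h, Even h → ∀ t, evenPeaks h (insertArch s t) = evenPeaks (h + 1) s + evenPeaks h t := by
  have odd_peak : ∀ h : ℤ, Even h → ¬ Even (h + 1) := fun h hh => by
    rw [Int.not_even_iff_odd]; exact hh.add_one
  induction s with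
  | nil =>
    refine ⟨fun h _ => rfl, fun h _ => rfl, fun h hh t => ?_⟩
    simp [insertArch, evenPeaks, odd_peak h hh]
  | flat s ih =>
    refine ⟨fun h hh => ?_, fun h hh => ?_, fun h hh t => ?_⟩
    · simp [evenMap, evenPeaks, odd_peak h hh, ih.1 h hh]
    · simp [oddMap, evenPeaks, ih.2.1 h hh]
    · rw [insertArch, ih.2.2 h hh]; rfl
  | arch b t ihb iht =>
    refine ⟨fun h hh => ?_, fun h hh => ?_, fun h hh u => ?_⟩
    · simp [evenMap, evenPeaks, odd_peak h hh, ihb.2.2 h hh, iht.1 h hh]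
    · simp [oddMap, evenPeaks, evenMap_eq_nil, ihb.1 _ hh.add_one, iht.2.1 h hh]
    · simp [insertArch, evenPeaks, odd_peak h hh, evenMap_eq_nil, ihb.1 _ hh.add_one.add_one,
        iht.2.1 _ hh.add_one]

theorem archOrFlat_of_ne_nil {b : SchroderTree} (hb : b ≠ nil) (t : SchroderTree) :
    archOrFlat b t = arch b t := by
  cases b <;> simp_all [archOrFlat]

theorem evenMap_archOrFlat (b t : SchroderTree) :
    evenMap (archOrFlat b t) = insertArch b (evenMap t) := by
  cases b <;> simp [archOrFlat, evenMap, insertArch]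

theorem insertArch_flats (j : ℕ) (b s : SchroderTree) :
    insertArch (flats j b) s = insertArch b (flats j s) := by
  induction j generalizing s with
  | zero => rfl
  | succ j ih => rw [flats, insertArch, ih, flats_flat, flats]

theorem insertArch_of_not_isFlat {b : SchroderTree} (hb : ¬ IsFlat (oddMap b))
    (s : SchroderTree) : insertArch b s = arch (oddMap b) s := by
  cases b <;> simp_all [insertArch, oddMap, IsFlat]

theorem noOdd_archOrFlat {h : ℤ} {b t : SchroderTree} (hb : NoOdd (h + 1) b)
    (ht : NoOdd h t) : NoOdd h (archOrFlat b t) := by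
  cases b <;> simp_all [archOrFlat, NoOdd]

theorem preimages_maps (s : SchroderTree) :
    (∀ h, Even h → NoOdd h s → (preimages (evenMap s)).2 = (0, s)) ∧
    (∀ h, Odd h → NoOdd h s → (preimages (oddMap s)).1 = s) ∧
    ∀ h, Odd h → NoOdd h s → ∀ t, (preimages (insertArch s t)).2 =
      (0, archOrFlat (flats (preimages t).2.1 s) (preimages t).2.2) := by
  induction s with
  | nil => exact ⟨fun _ _ _ => rfl, fun _ _ _ => rfl, fun _ _ _ _ => rfl⟩
  | flat s ih =>
    refine ⟨fun h hh hs => ?_, fun h hh hs => ?_, fun h hh hs t => ?_⟩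
    · simp [evenMap, preimages, ih.1 h hh hs, flats, archOrFlat]
    · simp [oddMap, preimages, ih.2.1 h hh hs]
    · rw [insertArch, ih.2.2 h hh hs, flats_flat]; rfl
  | arch b t ihb iht =>
    refine ⟨fun h hh hs => ?_, fun h hh hs => ?_, fun h hh hs u => ?_⟩
    · have hb : b ≠ nil := fun e => hs.1 ⟨e, hh.add_one⟩
      rw [evenMap, ihb.2.2 _ hh.add_one hs.2.1, iht.1 h hh hs.2.2]
      simp [flats, archOrFlat_of_ne_nil hb]
    · simp [oddMap, preimages, ihb.1 _ hh.add_one hs.2.1, iht.2.1 h hh hs.2.2]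
    · simp [insertArch, preimages, ihb.1 _ hh.add_one hs.2.1, iht.2.1 h hh hs.2.2]

theorem maps_preimages {s : SchroderTree} (hs : NoUH s) :
    oddMap (preimages s).1 = s ∧ flats (preimages s).2.1 (evenMap (preimages s).2.2) = s ∧
      (¬ IsFlat s → (preimages s).2.1 = 0) ∧
      (∀ h, Odd h → NoOdd h (preimages s).1) ∧ ∀ h, Even h → NoOdd h (preimages s).2.2 := by
  induction s with
  | nil => simp [preimages, oddMap, evenMap, flats, NoOdd]
  | flat s ih =>
    obtain ⟨h1, h2, -, h4, h5⟩ := ih hs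
    refine ⟨by simp [preimages, oddMap, h1], by simp [preimages, flats, h2], fun h => ?_, ?_, h5⟩
    · exact absurd trivial h
    · exact h4
  | arch b t ihb iht =>
    obtain ⟨hflat, hb, ht⟩ := hs
    obtain ⟨b1, b2, b3, b4, b5⟩ := ihb hb
    obtain ⟨t1, t2, -, t4, t5⟩ := iht ht
    rw [b3 hflat, flats] at b2
    refine ⟨by simp [preimages, oddMap, b2, t1], ?_, fun _ => rfl, fun h hh => ?_, fun h hh => ?_⟩
    · rw [preimages, flats, evenMap_archOrFlat, insertArch_flats, t2,
        insertArch_of_not_isFlat (by rwa [b1]), b1]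
    · refine ⟨fun e => ?_, b5 _ hh.add_one, t4 h hh⟩
      exact Int.not_even_iff_odd.2 e.2 hh.add_one
    · exact noOdd_archOrFlat ((noOdd_flats _ _ _).2 (b4 _ hh.add_one)) (t5 h hh)

theorem isFlat_or_eq_nil_or_isArch (s : SchroderTree) :
    IsFlat s ∨ s = nil ∨ (toPath s)[0]? = some SStep.U := by
  cases s <;> simp [IsFlat, toPath]

theorem card_noOdd_eq_card_noUH {n : ℕ} (hn : 1 ≤ n) (k : ℕ) :
    Nat.card {s | size s = n ∧ NoOdd 0 s ∧ evenPeaks 0 s = k} =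
    Nat.card {s | size s = n ∧ NoUH s ∧ (toPath s)[0]? = some SStep.U ∧ evenPeaks 0 s = k} := by
  have not_flat : ∀ s, (toPath s)[0]? = some SStep.U → ¬ IsFlat s := fun s => by
    cases s <;> simp [IsFlat, toPath]
  have right_inv : ∀ s, NoUH s → (toPath s)[0]? = some SStep.U →
      evenMap (preimages s).2.2 = s := fun s hs hU => by
    have h := maps_preimages hs
    simpa [h.2.2.1 (not_flat s hU), flats] using h.2.1
  refine Nat.card_congr ⟨fun s => ⟨evenMap s, ?_⟩, fun s => ⟨(preimages s).2.2, ?_⟩, ?_, ?_⟩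
  · obtain ⟨s, h1, -, h3⟩ := s
    refine ⟨by rw [(size_maps s).1, h1], (noUH_maps s).1, ?_,
      by rw [(evenPeaks_maps s).1 0 Even.zero, h3]⟩
    rcases isFlat_or_eq_nil_or_isArch (evenMap s) with h | h | h
    · exact absurd h (not_isFlat_evenMap s)
    · rw [evenMap_eq_nil] at h
      subst h
      simp only [size] at h1
      omega
    · exact h
  · obtain ⟨s, h1, h2, h3, h4⟩ := s
    have h := right_inv s h2 h3
    refine ⟨?_, (maps_preimages h2).2.2.2.2 0 Even.zero, ?_⟩
    · rw [← (size_maps _).1, h, h1]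
    · rw [← (evenPeaks_maps _).1 0 Even.zero, h, h4]
  · rintro ⟨s, h1, h2, h3⟩
    simp [(preimages_maps s).1 0 Even.zero h2]
  · rintro ⟨s, h1, h2, h3, h4⟩
    simp [right_inv s h2 h3]

end SchroderTree

open SchroderTree

theorem sHeight_zero (L : List SStep) : sHeight L 0 = 0 := rfl

theorem sHeight_cons_succ (a : SStep) (L : List SStep) (i : ℕ) :
    sHeight (a :: L) (i + 1) = a.eff + sHeight L i := by
  simp [sHeight]

/-- `L`, started at height `h`, never goes below the x-axis. -/
def StaysNonneg (h : ℤ) (L : List SStep) : Prop := ∀ i, 0 ≤ h + sHeight L i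

theorem staysNonneg_cons {h : ℤ} {a : SStep} {L : List SStep} :
    StaysNonneg h (a :: L) ↔ 0 ≤ h ∧ StaysNonneg (h + a.eff) L := by
  refine ⟨fun H => ⟨by simpa [sHeight_zero] using H 0, fun i => ?_⟩, fun H i => ?_⟩
  · simpa [sHeight_cons_succ, add_assoc] using H (i + 1)
  · cases i with
    | zero => simpa [sHeight_zero] using H.1
    | succ i => simpa [sHeight_cons_succ, add_assoc] using H.2 i

/-- `L`, started at height `h`, has no up step immediately followed by `b` at a height in `Q`. -/
def AvoidsAfterU (b : SStep) (Q : ℤ → Prop) (h : ℤ) (L : List SStep) : Prop :=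
  ∀ i, ¬ (L[i]? = some SStep.U ∧ L[i + 1]? = some b ∧ Q (h + sHeight L (i + 1)))

theorem avoidsAfterU_cons {b : SStep} {Q : ℤ → Prop} {h : ℤ} {a : SStep} {L : List SStep} :
    AvoidsAfterU b Q h (a :: L) ↔
      ¬ (a = SStep.U ∧ L[0]? = some b ∧ Q (h + a.eff)) ∧ AvoidsAfterU b Q (h + a.eff) L := by
  refine ⟨fun H => ⟨?_, fun i => ?_⟩, fun H i => ?_⟩
  · simpa [sHeight_cons_succ, sHeight_zero] using H 0
  · simpa [sHeight_cons_succ, add_assoc] using H (i + 1)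
  · cases i with
    | zero => simpa [sHeight_cons_succ, sHeight_zero] using H.1
    | succ i => simpa [sHeight_cons_succ, add_assoc] using H.2 i

/-- The number of peaks of even height greater than `2` of `L`, started at height `h`. -/
def evenHighPeaksFrom (h : ℤ) (L : List SStep) : ℕ :=
  ((Finset.range L.length).filter
    (fun i => L[i]? = some SStep.U ∧ L[i+1]? = some SStep.D ∧
      Even (h + sHeight L (i+1)) ∧ 2 < h + sHeight L (i+1))).card

theorem evenHighPeaksFrom_cons (h : ℤ) (a : SStep) (L : List SStep) :
    evenHighPeaksFrom h (a :: L) =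
      (if a = SStep.U ∧ L[0]? = some SStep.D ∧ Even (h + a.eff) ∧ 2 < h + a.eff then 1 else 0) +
        evenHighPeaksFrom (h + a.eff) L := by
  simp only [evenHighPeaksFrom, Finset.card_filter, List.length_cons, Finset.sum_range_succ',
    List.getElem?_cons_succ, List.getElem?_cons_zero, sHeight_cons_succ, sHeight_zero, add_assoc,
    add_zero, Option.some.injEq]
  rw [add_comm]

namespace SchroderTree

theorem toPath_append_head_eq_D (b : SchroderTree) (L : List SStep) :
    (toPath b ++ SStep.D :: L)[0]? = some SStep.D ↔ b = nil := by
  cases b <;> simp [toPath]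

theorem toPath_append_head_eq_H (b : SchroderTree) (L : List SStep) :
    (toPath b ++ SStep.D :: L)[0]? = some SStep.H ↔ IsFlat b := by
  cases b <;> simp [toPath, IsFlat]

theorem evenHighPeaksFrom_toPath_append (s : SchroderTree) (h : ℤ) (L : List SStep) :
    evenHighPeaksFrom h (toPath s ++ L) = evenPeaks h s + evenHighPeaksFrom h L := by
  induction s generalizing h L with
  | nil => simp [toPath, evenPeaks]
  | flat s ih => simp [toPath, evenPeaks, evenHighPeaksFrom_cons, ih, SStep.eff]
  | arch b t ihb iht =>
    simp only [toPath, evenPeaks, List.cons_append, List.append_assoc, evenHighPeaksFrom_cons,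
      ihb, iht, toPath_append_head_eq_D, SStep.eff]
    simp [add_assoc]

theorem avoidsAfterU_D_toPath_append (s : SchroderTree) (h : ℤ) (L : List SStep) :
    AvoidsAfterU SStep.D Odd h (toPath s ++ L) ↔ NoOdd h s ∧ AvoidsAfterU SStep.D Odd h L := by
  induction s generalizing h L with
  | nil => simp [toPath, NoOdd]
  | flat s ih => simp [toPath, NoOdd, avoidsAfterU_cons, ih, SStep.eff]
  | arch b t ihb iht =>
    simp only [toPath, NoOdd, List.cons_append, List.append_assoc, avoidsAfterU_cons,
      ihb, iht, toPath_append_head_eq_D, SStep.eff]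
    simp [and_assoc]

theorem avoidsAfterU_H_toPath_append (s : SchroderTree) (h : ℤ) (L : List SStep) :
    AvoidsAfterU SStep.H (fun _ => True) h (toPath s ++ L) ↔
      NoUH s ∧ AvoidsAfterU SStep.H (fun _ => True) h L := by
  induction s generalizing h L with
  | nil => simp [toPath, NoUH]
  | flat s ih => simp [toPath, NoUH, avoidsAfterU_cons, ih, SStep.eff]
  | arch b t ihb iht =>
    simp only [toPath, NoUH, List.cons_append, List.append_assoc, avoidsAfterU_cons,
      ihb, iht, toPath_append_head_eq_H, SStep.eff]
    simp [and_assoc]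

theorem staysNonneg_toPath_append (s : SchroderTree) {h : ℤ} (hh : 0 ≤ h) {L : List SStep}
    (hL : StaysNonneg h L) : StaysNonneg h (toPath s ++ L) := by
  induction s generalizing h L with
  | nil => exact hL
  | flat s ih =>
    simp only [toPath, List.cons_append, staysNonneg_cons, SStep.eff, add_zero]
    exact ⟨hh, ih hh hL⟩
  | arch b t ihb iht =>
    simp only [toPath, List.cons_append, List.append_assoc, staysNonneg_cons, SStep.eff]
    refine ⟨hh, ihb (by omega) (staysNonneg_cons.2 ⟨by omega, ?_⟩)⟩
    simpa [SStep.eff] using iht hh hL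

theorem evenHighPeaks_toPath (s : SchroderTree) : evenHighPeaks (toPath s) = evenPeaks 0 s := by
  have h := evenHighPeaksFrom_toPath_append s 0 []
  simpa [evenHighPeaksFrom, evenHighPeaks] using h

theorem noOddPeak_toPath (s : SchroderTree) : NoOddPeak (toPath s) ↔ NoOdd 0 s := by
  have h := avoidsAfterU_D_toPath_append s 0 []
  simpa [AvoidsAfterU, NoOddPeak, IsPeakAt] using h

theorem uhFree_toPath (s : SchroderTree) : UHFree (toPath s) ↔ NoUH s := by
  have h := avoidsAfterU_H_toPath_append s 0 []
  simpa [AvoidsAfterU, UHFree] using h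

theorem sum_len_toPath (s : SchroderTree) : ((toPath s).map SStep.len).sum = 2 * size s := by
  induction s with
  | nil => rfl
  | flat s ih => simp [toPath, size, SStep.len, ih]; ring
  | arch b t ihb iht => simp [toPath, size, SStep.len, ihb, iht]; ring

theorem sum_eff_toPath (s : SchroderTree) : ((toPath s).map SStep.eff).sum = 0 := by
  induction s with
  | nil => rfl
  | flat s ih => simp [toPath, SStep.eff, ih]
  | arch b t ihb iht => simp [toPath, SStep.eff, ihb, iht]

theorem isSchroder_toPath (s : SchroderTree) (n : ℕ) : IsSchroder (toPath s) n ↔ size s = n := by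
  have h : StaysNonneg 0 (toPath s) := by
    have h0 : StaysNonneg 0 [] := fun i => by simp [sHeight]
    simpa using staysNonneg_toPath_append s le_rfl h0
  simp only [IsSchroder, sum_len_toPath, sum_eff_toPath, true_and]
  exact ⟨fun H => by omega, fun H => ⟨by omega, fun i => by simpa using h i⟩⟩

theorem toPath_append_injective {s s' : SchroderTree} {L L' : List SStep}
    (hL : ∀ a ∈ L.head?, a = SStep.D) (hL' : ∀ a ∈ L'.head?, a = SStep.D)
    (h : toPath s ++ L = toPath s' ++ L') : s = s' ∧ L = L' := by
  induction s generalizing s' L L' with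
  | nil =>
    cases s' <;> simp_all [toPath]
  | flat s ih =>
    cases s' with
    | nil => simp only [toPath, List.nil_append] at h; simp [← h] at hL'
    | flat s' =>
      simp only [toPath, List.cons_append, List.cons.injEq, true_and] at h
      simpa using ih hL hL' h
    | arch b' t' => simp [toPath] at h
  | arch b t ihb iht =>
    cases s' with
    | nil => simp only [toPath, List.nil_append] at h; simp [← h] at hL'
    | flat s' => simp [toPath] at h
    | arch b' t' =>
      simp only [toPath, List.cons_append, List.append_assoc, List.cons.injEq, true_and] at h
      obtain ⟨rfl, ht⟩ := ihb (by simp) (by simp) h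
      simpa using iht hL hL' (List.cons.inj ht).2

theorem toPath_injective : Function.Injective toPath := fun s s' h =>
  (toPath_append_injective (L := []) (L' := []) (by simp) (by simp) (by simpa using h)).1

/-- The path from height `rs.length` to `0` made of `s` and the trees in `rs`, separated by
down steps. -/
def descent (s : SchroderTree) : List SchroderTree → List SStep
  | [] => toPath s
  | r :: rs => toPath s ++ SStep.D :: descent r rs

theorem exists_descent (L : List SStep) (h : ℕ) (hsum : h + (L.map SStep.eff).sum = 0)
    (hL : StaysNonneg h L) : ∃ s rs, rs.length = h ∧ descent s rs = L := by
  induction L generalizing h with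
  | nil =>
    refine ⟨nil, [], ?_, rfl⟩
    simp only [List.map_nil, List.sum_nil] at hsum
    simp only [List.length_nil]
    omega
  | cons a L ih =>
    obtain ⟨-, hL⟩ := staysNonneg_cons.1 hL
    simp only [List.map_cons, List.sum_cons] at hsum
    cases a with
    | U =>
      obtain ⟨s, rs, hlen, hs⟩ := ih (h + 1) (by simp only [SStep.eff] at hsum; push_cast; omega)
        (by simpa [SStep.eff] using hL)
      cases rs with
      | nil => simp at hlen
      | cons r rs =>
        refine ⟨arch s r, rs, by simpa using hlen, ?_⟩
        rw [← hs]
        cases rs <;> simp [descent, toPath]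
    | D =>
      have h1 : 1 ≤ h := by
        have := hL 0
        simp only [sHeight_zero, SStep.eff] at this
        omega
      obtain ⟨m, rfl⟩ := Nat.exists_eq_add_of_le' h1
      obtain ⟨s, rs, hlen, hs⟩ := ih m (by simp only [SStep.eff] at hsum; push_cast at hsum; omega)
        (by simpa [SStep.eff] using hL)
      exact ⟨nil, s :: rs, by simpa using hlen, by simp [descent, toPath, hs]⟩
    | H =>
      obtain ⟨s, rs, hlen, hs⟩ := ih h (by simpa [SStep.eff] using hsum)
        (by simpa [SStep.eff] using hL)
      refine ⟨flat s, rs, hlen, ?_⟩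
      rw [← hs]
      cases rs <;> simp [descent, toPath]

theorem exists_toPath_eq {L : List SStep} {n : ℕ} (hL : IsSchroder L n) :
    ∃ s, toPath s = L := by
  obtain ⟨s, rs, hlen, hs⟩ := exists_descent L 0 (by simpa using hL.2.1)
    (fun i => by simpa using hL.2.2 i)
  rw [List.length_eq_zero_iff] at hlen
  subst hlen
  exact ⟨s, hs⟩

theorem card_isSchroder_and (n : ℕ) (P : List SStep → Prop) :
    Nat.card {L : List SStep // IsSchroder L n ∧ P L} =
      Nat.card {s | size s = n ∧ P (toPath s)} := by
  rw [← Nat.card_image_of_injective toPath_injective]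
  refine Nat.card_congr (Equiv.subtypeEquivRight fun L => ⟨fun ⟨h1, h2⟩ => ?_, ?_⟩)
  · obtain ⟨s, rfl⟩ := exists_toPath_eq h1
    exact ⟨s, ⟨(isSchroder_toPath s n).1 h1, h2⟩, rfl⟩
  · rintro ⟨s, ⟨h1, h2⟩, rfl⟩
    exact ⟨(isSchroder_toPath s n).2 h1, h2⟩

end SchroderTree

/-- For all integers `n ≥ 1` and `k ≥ 0`, the number of Schröder paths of length `2n`
having no peak of odd height and exactly `k` peaks of even height greater than `2` equals
the number of UH-free Schröder paths of length `2n` whose first step is `U` and which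
have exactly `k` peaks of even height greater than `2`. -/
theorem stmt12 (n k : ℕ) (hn : 1 ≤ n) :
    Nat.card {L : List SStep // IsSchroder L n ∧ NoOddPeak L ∧ evenHighPeaks L = k} =
    Nat.card {L : List SStep // IsSchroder L n ∧ UHFree L ∧ L[0]? = some SStep.U ∧
        evenHighPeaks L = k} := by
  rw [card_isSchroder_and n fun L => NoOddPeak L ∧ evenHighPeaks L = k,
    card_isSchroder_and n fun L => UHFree L ∧ L[0]? = some SStep.U ∧ evenHighPeaks L = k]
  simpa only [noOddPeak_toPath, uhFree_toPath, evenHighPeaks_toPath] using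
    card_noOdd_eq_card_noUH hn k
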